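/- arXiv:1607.03075 — 6 statements merged into one kernel-verified Lean document; each statement's English description precedes it below -/
import Mathlib

section
/- Pauli Twirl (distinct-Pauli case): Let n : ℕ and let s, s' : Fin n → Fin 4 be two distinct Pauli labels. Then for every matrix ρ : Matrix (Fin n → Fin 2) (Fin n → Fin 2) ℂ, the sum over all n-qubit Pauli labels q : Fin n → Fin 4 of (P_q * P_s * P_q) * ρ * (P_q * P_{s'} * P_q) equals the zero matrix. (Since each Pauli tensor is Hermitian and self-inverse, P_q = P_q† and P_{s'} = P_{s'}†, so this is the statement Σ_Q Q†PQ ρ Q†P'†Q = 0 for P ≠ P'.) -/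
open Matrix

/-- Single-qubit Pauli matrices indexed by `Fin 4`: I, X, Y, Z. -/
def pauli : Fin 4 → Matrix (Fin 2) (Fin 2) ℂ
  | 0 => !![1, 0; 0, 1]
  | 1 => !![0, 1; 1, 0]
  | 2 => !![0, -Complex.I; Complex.I, 0]
  | 3 => !![1, 0; 0, -1]

/-- The `n`-qubit Pauli tensor indexed by a label `s : Fin n → Fin 4`. -/
def pauliTensor {n : ℕ} (s : Fin n → Fin 4) :
    Matrix (Fin n → Fin 2) (Fin n → Fin 2) ℂ :=
  Matrix.of fun f g => ∏ k, pauli (s k) (f k) (g k)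

/-- The commutation sign of two single-qubit Paulis: `1` if they commute and `-1` otherwise. -/
def pauliSign (a b : Fin 4) : ℂ :=
  if a = 0 ∨ b = 0 ∨ a = b then 1 else -1

lemma pauli_conj (a b : Fin 4) :
    pauli a * pauli b * pauli a = pauliSign a b • pauli b := by
  fin_cases a <;> fin_cases b <;> ext i j <;> fin_cases i <;> fin_cases j <;>
    simp [pauli, pauliSign, Matrix.mul_apply, Fin.sum_univ_two]

lemma sum_pauliSign_mul_pauliSign {a b : Fin 4} (hab : a ≠ b) :
    ∑ q, pauliSign q a * pauliSign q b = 0 := by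
  fin_cases a <;> fin_cases b <;> simp [pauliSign, Fin.sum_univ_four] at hab ⊢

/-- Tensor products of matrices multiply factorwise. -/
lemma Matrix.of_prod_mul_of_prod {ι m R : Type*} [Fintype ι] [DecidableEq ι] [Fintype m]
    [CommSemiring R] (A B : ι → Matrix m m R) :
    (Matrix.of fun f g : ι → m => ∏ k, A k (f k) (g k)) *
        (Matrix.of fun f g : ι → m => ∏ k, B k (f k) (g k)) =
      Matrix.of fun f g : ι → m => ∏ k, (A k * B k) (f k) (g k) := by
  ext f g
  simp only [Matrix.mul_apply, Matrix.of_apply, ← Finset.prod_mul_distrib, Fintype.prod_sum]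

lemma pauliTensor_conj {n : ℕ} (q s : Fin n → Fin 4) :
    pauliTensor q * pauliTensor s * pauliTensor q =
      (∏ k, pauliSign (q k) (s k)) • pauliTensor s := by
  unfold pauliTensor
  rw [Matrix.of_prod_mul_of_prod (fun k => pauli (q k)) (fun k => pauli (s k)),
    Matrix.of_prod_mul_of_prod (fun k => pauli (q k) * pauli (s k)) (fun k => pauli (q k))]
  ext f g
  simp [pauli_conj, Finset.prod_mul_distrib]

lemma sum_prod_pauliSign_mul {n : ℕ} {s s' : Fin n → Fin 4} (hss : s ≠ s') :
    ∑ q : Fin n → Fin 4, (∏ k, pauliSign (q k) (s k)) * ∏ k, pauliSign (q k) (s' k) = 0 := by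
  obtain ⟨k, hk⟩ := Function.ne_iff.mp hss
  simp only [← Finset.prod_mul_distrib]
  rw [← Fintype.prod_sum fun k a => pauliSign a (s k) * pauliSign a (s' k)]
  exact Finset.prod_eq_zero (Finset.mem_univ k) (sum_pauliSign_mul_pauliSign hk)

/-- Pauli twirl, distinct-Pauli case. -/
theorem pauli_twirl_ne (n : ℕ) (s s' : Fin n → Fin 4) (hss : s ≠ s')
    (ρ : Matrix (Fin n → Fin 2) (Fin n → Fin 2) ℂ) :
    ∑ q : Fin n → Fin 4,
      (pauliTensor q * pauliTensor s * pauliTensor q) * ρ *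
        (pauliTensor q * pauliTensor s' * pauliTensor q) = 0 := by
  simp only [pauliTensor_conj, Matrix.smul_mul, Matrix.mul_smul, smul_smul]
  rw [← Finset.sum_smul]
  simp only [mul_comm, sum_prod_pauliSign_mul hss, zero_smul]
end

section
/- Trap code security bound (numeric form): For all n, t : ℕ with t + 1 ≤ n, the real number (Nat.choose n (t + 1) * (t + 1)! * (3 * n - (t + 1))!) / (3 * n)! is at most (1 / 3) ^ (t + 1). -/
theorem Nat.pow_mul_descFactorial_le (c n k : ℕ) (hc : 1 ≤ c) :
    c ^ k * n.descFactorial k ≤ (c * n).descFactorial k := by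
  induction k with
  | zero => simp
  | succ k ih =>
    have hk : c * (n - k) ≤ c * n - k := by
      rw [Nat.mul_sub]
      exact Nat.sub_le_sub_left (Nat.le_mul_of_pos_left k hc) _
    calc c ^ (k + 1) * n.descFactorial (k + 1)
        = (c * (n - k)) * (c ^ k * n.descFactorial k) := by
          rw [Nat.descFactorial_succ]; ring
      _ ≤ (c * n - k) * (c * n).descFactorial k := Nat.mul_le_mul hk ih
      _ = (c * n).descFactorial (k + 1) := (Nat.descFactorial_succ _ _).symm

/-- Trap code security bound, numeric form. -/
theorem trap_code_bound (n t : ℕ) (h : t + 1 ≤ n) :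
    ((Nat.choose n (t + 1) * Nat.factorial (t + 1) *
        Nat.factorial (3 * n - (t + 1)) : ℕ) : ℝ) /
      ((Nat.factorial (3 * n) : ℕ) : ℝ) ≤ (1 / 3 : ℝ) ^ (t + 1) := by
  have key : 3 ^ (t + 1) * (n.choose (t + 1) * (t + 1).factorial *
      (3 * n - (t + 1)).factorial) ≤ (3 * n).factorial := by
    rw [mul_comm (n.choose _), ← Nat.descFactorial_eq_factorial_mul_choose, ← mul_assoc,
      ← Nat.factorial_mul_descFactorial (show t + 1 ≤ 3 * n by omega),
      mul_comm (3 * n - (t + 1)).factorial]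
    exact Nat.mul_le_mul_right _ (Nat.pow_mul_descFactorial_le 3 n (t + 1) (by norm_num))
  rw [one_div, inv_pow, div_le_iff₀ (by positivity), ← div_eq_inv_mul,
    le_div_iff₀ (by positivity), mul_comm]
  exact_mod_cast key
end

section
/- Hilbert–Schmidt orthogonality of Pauli tensors: For all n : ℕ and all labels s, s' : Fin n → Fin 4, the trace of P_s * P_{s'} equals (2 ^ n : ℂ) if s = s' and equals 0 otherwise. In particular, every non-identity n-qubit Pauli tensor has trace zero. -/
open Matrix

/-- Single-qubit Pauli matrices are orthogonal for the trace pairing. -/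
theorem pauli_mul_trace (a b : Fin 4) :
    (pauli a * pauli b).trace = if a = b then (2 : ℂ) else 0 := by
  fin_cases a <;> fin_cases b <;>
    simp [pauli, Matrix.trace, Fin.sum_univ_two] <;> norm_num

/-- The trace of a product of Pauli tensors factors over the qubits. -/
theorem pauliTensor_mul_trace {n : ℕ} (s s' : Fin n → Fin 4) :
    (pauliTensor s * pauliTensor s').trace = ∏ k, (pauli (s k) * pauli (s' k)).trace := by
  simp only [Matrix.trace, Matrix.diag_apply, Matrix.mul_apply, pauliTensor, Matrix.of_apply,
    ← Finset.prod_mul_distrib, Finset.prod_univ_sum, Fintype.piFinset_univ]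

/-- Hilbert–Schmidt orthogonality of Pauli tensors. -/
theorem pauli_trace_orthogonal (n : ℕ) (s s' : Fin n → Fin 4) :
    (pauliTensor s * pauliTensor s').trace =
      if s = s' then (2 ^ n : ℂ) else 0 := by
  simp only [pauliTensor_mul_trace, pauli_mul_trace]
  split_ifs with h
  · simp [h]
  · obtain ⟨k, hk⟩ := Function.ne_iff.mp h
    exact Finset.prod_eq_zero (Finset.mem_univ k) (if_neg hk)
end

section
/- Computational-basis traps detect Pauli attacks with an X or Y component: Let d : ℕ and let E : Matrix (Fin d → Fin 2) (Fin d → Fin 2) ℂ be the matrix with E f g = 1 if f and g are both the constant-0 function and E f g = 0 otherwise (i.e., E = (|0⟩⟨0|)^{⊗d}). Then for every label s : Fin d → Fin 4: E * P_s * E * P_s * E = E if for every j, s j = 0 or s j = 3, and E * P_s * E * P_s * E = 0 otherwise. -/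
open Matrix

/-- The projector `(|0⟩⟨0|)^{⊗ d}` onto all trap qubits being `|0⟩`. -/
def zeroTrap (d : ℕ) : Matrix (Fin d → Fin 2) (Fin d → Fin 2) ℂ :=
  Matrix.of fun f g => if f = (fun _ => 0) ∧ g = (fun _ => 0) then 1 else 0

theorem zeroTrap_eq_single (d : ℕ) : zeroTrap d = Matrix.single 0 0 1 := by
  ext f g
  simp only [zeroTrap, Matrix.of_apply, Matrix.single_apply, eq_comm (a := (0 : Fin d → Fin 2))]
  rfl

/-- Compressing an operator by the trap projector leaves its vacuum matrix entry. -/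
theorem zeroTrap_mul_mul_zeroTrap {d : ℕ} (A : Matrix (Fin d → Fin 2) (Fin d → Fin 2) ℂ) :
    zeroTrap d * A * zeroTrap d = A 0 0 • zeroTrap d := by
  simp [zeroTrap_eq_single, Matrix.single_mul_mul_single, Matrix.smul_single]

theorem pauli_zero_zero (a : Fin 4) : pauli a 0 0 = if a = 0 ∨ a = 3 then 1 else 0 := by
  fin_cases a <;> simp [pauli]

theorem pauliTensor_zero_zero {n : ℕ} (s : Fin n → Fin 4) :
    pauliTensor s 0 0 = if ∀ j, s j = 0 ∨ s j = 3 then 1 else 0 := by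
  simp [pauliTensor, pauli_zero_zero, Finset.prod_ite_zero]

/-- Computational-basis traps detect Pauli attacks with an X or Y component. -/
theorem zero_trap_detection (d : ℕ) (s : Fin d → Fin 4) :
    zeroTrap d * pauliTensor s * zeroTrap d * pauliTensor s * zeroTrap d =
      if ∀ j, s j = 0 ∨ s j = 3 then zeroTrap d else 0 := by
  rw [zeroTrap_mul_mul_zeroTrap, Matrix.smul_mul, Matrix.smul_mul, zeroTrap_mul_mul_zeroTrap,
    pauliTensor_zero_zero]
  split_ifs <;> simp
end

section
/- Hadamard-basis traps detect Pauli attacks with a Z or Y component: Let d : ℕ and let F : Matrix (Fin d → Fin 2) (Fin d → Fin 2) ℂ be the matrix with F f g = (1 / 2 ^ d : ℂ) for all f, g (i.e., F = (|+⟩⟨+|)^{⊗d}). Then for every label s : Fin d → Fin 4: F * P_s * F * P_s * F = F if for every j, s j = 0 or s j = 1, and F * P_s * F * P_s * F = 0 otherwise. -/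
open Matrix

/-- The projector `(|+⟩⟨+|)^{⊗ d}` onto all trap qubits being `|+⟩`. -/
noncomputable def plusTrap (d : ℕ) : Matrix (Fin d → Fin 2) (Fin d → Fin 2) ℂ :=
  Matrix.of fun _ _ => (1 / 2 ^ d : ℂ)

/-- Compressing a matrix by `plusTrap` rescales `plusTrap` by the normalized sum of its entries. -/
theorem plusTrap_mul_mul_plusTrap {d : ℕ}
    (A : Matrix (Fin d → Fin 2) (Fin d → Fin 2) ℂ) :
    plusTrap d * A * plusTrap d = ((∑ f, ∑ g, A f g) / 2 ^ d) • plusTrap d := by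
  ext f g
  simp only [plusTrap, mul_apply, of_apply, Matrix.smul_apply, smul_eq_mul, ← Finset.sum_mul,
    ← Finset.mul_sum]
  rw [Finset.sum_comm]
  ring

theorem sum_sum_pauli (i : Fin 4) :
    ∑ a, ∑ b, pauli i a b = if i = 0 ∨ i = 1 then 2 else 0 := by
  fin_cases i <;> simp [pauli, Fin.sum_univ_two] <;> norm_num

theorem sum_sum_pauliTensor {d : ℕ} (s : Fin d → Fin 4) :
    ∑ f, ∑ g, pauliTensor s f g = if ∀ j, s j = 0 ∨ s j = 1 then 2 ^ d else 0 := by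
  have hprod : ∑ f, ∑ g, pauliTensor s f g = ∏ k, ∑ a, ∑ b, pauli (s k) a b := by
    simp only [pauliTensor, of_apply, Fintype.prod_sum]
  simp only [hprod, sum_sum_pauli]
  split_ifs with h
  · simp [h]
  · push Not at h
    obtain ⟨j, hj⟩ := h
    exact Finset.prod_eq_zero (Finset.mem_univ j) (by simp [hj])

/-- Hadamard-basis traps detect Pauli attacks with a Z or Y component. -/
theorem plus_trap_detection (d : ℕ) (s : Fin d → Fin 4) :
    plusTrap d * pauliTensor s * plusTrap d * pauliTensor s * plusTrap d =
      if ∀ j, s j = 0 ∨ s j = 1 then plusTrap d else 0 := by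
  rw [plusTrap_mul_mul_plusTrap, smul_mul_assoc, smul_mul_assoc, plusTrap_mul_mul_plusTrap,
    sum_sum_pauliTensor]
  split_ifs <;> simp
end

section
/- Bell-pair measurement detects Pauli attacks (generalized Bell states are orthonormal): Let m : ℕ and define Φ : ((Fin m → Fin 2) × (Fin m → Fin 2)) → ℂ by Φ (f, g) = (Real.sqrt 2)⁻¹ ^ m if f = g and 0 otherwise (the state of m EPR pairs |Φ⁺⟩^{⊗m}, entangling the first m qubits with the last m). For each label s : Fin m → Fin 4, let v_s : ((Fin m → Fin 2) × (Fin m → Fin 2)) → ℂ be the vector obtained by applying P_s to the first m qubits: v_s (f, g) = ∑ h, P_s f h * Φ (h, g). Then for all labels s, s' : Fin m → Fin 4, the inner product ∑_{(f, g)} conj (v_s (f, g)) * v_{s'} (f, g) equals 1 if s = s' and 0 otherwise. -/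
open Matrix

/-- The state of `m` EPR pairs `|Φ⁺⟩^{⊗ m}`, entangling the first `m` qubits
with the last `m` qubits. -/
noncomputable def bellState (m : ℕ) :
    (Fin m → Fin 2) × (Fin m → Fin 2) → ℂ :=
  fun p => if p.1 = p.2 then (((Real.sqrt 2)⁻¹ : ℝ) : ℂ) ^ m else 0

/-- The vector obtained by applying the Pauli tensor `P_s` to the first `m`
qubits of `m` EPR pairs. -/
noncomputable def bellVec (m : ℕ) (s : Fin m → Fin 4) :
    (Fin m → Fin 2) × (Fin m → Fin 2) → ℂ :=
  fun p => ∑ h : Fin m → Fin 2, pauliTensor s p.1 h * bellState m (h, p.2)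

theorem bellVec_apply (m : ℕ) (s : Fin m → Fin 4) (f g : Fin m → Fin 2) :
    bellVec m s (f, g) = ∏ k, pauli (s k) (f k) (g k) * (((Real.sqrt 2)⁻¹ : ℝ) : ℂ) := by
  simp [bellVec, bellState, pauliTensor, Finset.prod_mul_distrib]

theorem star_inv_sqrt_two_mul_self :
    (starRingEnd ℂ) (((Real.sqrt 2)⁻¹ : ℝ) : ℂ) * (((Real.sqrt 2)⁻¹ : ℝ) : ℂ) = 1 / 2 := by
  rw [Complex.conj_ofReal, ← Complex.ofReal_mul, ← mul_inv,
    Real.mul_self_sqrt zero_le_two]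
  norm_num

theorem sum_star_pauli_mul_pauli (i j : Fin 4) :
    ∑ a, ∑ b, (starRingEnd ℂ) (pauli i a b) * pauli j a b = if i = j then 2 else 0 := by
  fin_cases i <;> fin_cases j <;> simp [pauli, Fin.sum_univ_two] <;> norm_num

/-- A sum over pairs of functions of a product of local terms is the product of local sums. -/
theorem sum_sum_prod_eq_prod_sum_sum {ι α β R : Type*} [Fintype ι] [DecidableEq ι]
    [Fintype α] [Fintype β] [CommSemiring R] (F : ι → α → β → R) :
    ∑ f : ι → α, ∑ g : ι → β, ∏ k, F k (f k) (g k) = ∏ k, ∑ a, ∑ b, F k a b := by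
  simp only [Finset.prod_univ_sum, Fintype.piFinset_univ]

/-- The generalized Bell states `(P_s ⊗ 1)|Φ⁺⟩^{⊗ m}` are orthonormal. -/
theorem bell_states_orthonormal (m : ℕ) (s s' : Fin m → Fin 4) :
    ∑ p : (Fin m → Fin 2) × (Fin m → Fin 2),
        (starRingEnd ℂ) (bellVec m s p) * bellVec m s' p =
      if s = s' then 1 else 0 := by
  rw [Fintype.sum_prod_type]
  simp only [bellVec_apply, map_prod, ← Finset.prod_mul_distrib]
  rw [sum_sum_prod_eq_prod_sum_sum fun k a b =>
    (starRingEnd ℂ) (pauli (s k) a b * (((Real.sqrt 2)⁻¹ : ℝ) : ℂ)) *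
      (pauli (s' k) a b * (((Real.sqrt 2)⁻¹ : ℝ) : ℂ))]
  have single (k : Fin m) :
      ∑ a, ∑ b, (starRingEnd ℂ) (pauli (s k) a b * (((Real.sqrt 2)⁻¹ : ℝ) : ℂ)) *
        (pauli (s' k) a b * (((Real.sqrt 2)⁻¹ : ℝ) : ℂ)) = if s k = s' k then 1 else 0 := by
    simp only [map_mul, mul_mul_mul_comm, star_inv_sqrt_two_mul_self, ← Finset.sum_mul,
      sum_star_pauli_mul_pauli]
    split_ifs <;> norm_num
  simp only [single, Finset.prod_ite_zero, Finset.prod_const_one, Finset.mem_univ,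
    true_imp_iff, funext_iff]
end
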